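/- There exist a universal constant c > 0 and an integer n₀ such that the following holds for all n ≥ n₀ and all m ≥ 4. Let X = [2^n] and let 𝒯 = {f_k : k ∈ [2^n]} be the class of thresholds, f_k(x) = 1 if x ≥ k and 0 otherwise. Let A be any (possibly randomized) consistent and proper learning algorithm for 𝒯 with sample size m, i.e., a map A : (X × {0,1})^m → (probability distributions on 𝒯) such that for every sample S realizable by 𝒯, the distribution A(S) is supported on thresholds with zero empirical error on S. Then there exists a distribution D on X × {0,1} realizable by 𝒯 such that, with S ~ D^m and h distributed according to A(S) given S, I(S; h) ≥ c·log₂(n)/m². -/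

import Mathlib

open scoped Classical

/-- Shannon entropy (in bits) of a distribution given by a weight function on a finite type. -/
noncomputable def ent {α : Type*} [Fintype α] (p : α → ℝ) : ℝ :=
  - ∑ a, p a * Real.logb 2 (p a)

/-- Mutual information (in bits) between the two coordinates of a joint distribution
given by a weight function on a finite product type. -/
noncomputable def mutInfo {α β : Type*} [Fintype α] [Fintype β] (μ : α × β → ℝ) : ℝ :=
  ent (fun a => ∑ b, μ (a, b)) + ent (fun b => ∑ a, μ (a, b)) - ent μ

/-- True error of a hypothesis `h : X → Bool` with respect to a distribution `D` on
`X × Bool`. -/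
noncomputable def trueErr {X : Type*} [Fintype X] (D : X × Bool → ℝ) (h : X → Bool) : ℝ :=
  ∑ z, D z * (if h z.1 ≠ z.2 then (1 : ℝ) else 0)

/-- The threshold hypothesis `f_k` on `Fin N`: `f_k x = 1` iff `x ≥ k`. -/
def thr {N : ℕ} (k : Fin N) : Fin N → Bool := fun x => decide (k ≤ x)

lemma ent_mul_log_two {α : Type*} [Fintype α] (p : α → ℝ) :
    ent p * Real.log 2 = - ∑ a, p a * Real.log (p a) := by
  have hlog2 : Real.log 2 ≠ 0 := (Real.log_pos one_lt_two).ne'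
  rw [ent, neg_mul, Finset.sum_mul]
  congr 1
  refine Finset.sum_congr rfl fun c _ => ?_
  rw [Real.logb]
  field_simp

lemma mul_log_add_sub_le {x a b w : ℝ} (hx : 0 ≤ x) (ha : x ≤ a) (hb : x ≤ b) (hw : 0 < w) :
    x * Real.log w + x - a * b * w ≤ x * (Real.log x - Real.log a - Real.log b) := by
  rcases hx.eq_or_lt with rfl | hx
  · simp only [zero_mul, zero_add, zero_sub, Left.neg_nonpos_iff]
    positivity
  · have ha' : 0 < a := hx.trans_le ha
    have hb' : 0 < b := hx.trans_le hb
    have h := Real.log_le_sub_one_of_pos (x := a * b * w / x) (by positivity)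
    rw [Real.log_div (by positivity) hx.ne', Real.log_mul (by positivity) hw.ne',
      Real.log_mul ha'.ne' hb'.ne'] at h
    have h2 := mul_le_mul_of_nonneg_left h hx.le
    have h3 : x * (a * b * w / x - 1) = a * b * w - x := by field_simp
    rw [h3] at h2
    linarith

/-- Gibbs-type lower bound on mutual information: the mass of an event `G` under the joint
distribution, weighed against its mass under the product of the marginals. -/
lemma le_mutInfo_of_event {α β : Type*} [Fintype α] [Fintype β] (μ : α × β → ℝ)
    (h0 : ∀ p, 0 ≤ μ p) (h1 : ∑ p, μ p = 1) (G : Finset (α × β)) {w : ℝ} (hw : 0 < w) :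
    (∑ p ∈ G, μ p) * Real.log w
        - (w - 1) * ∑ p ∈ G, (∑ b, μ (p.1, b)) * (∑ a, μ (a, p.2))
      ≤ mutInfo μ * Real.log 2 := by
  set μ₁ : α → ℝ := fun a => ∑ b, μ (a, b) with hμ₁
  set μ₂ : β → ℝ := fun b => ∑ a, μ (a, b) with hμ₂
  have hprod : ∑ p : α × β, μ₁ p.1 * μ₂ p.2 = 1 := by
    have e1 : ∑ a, μ₁ a = 1 := by rw [← h1, Fintype.sum_prod_type]
    have e2 : ∑ b, μ₂ b = 1 := by rw [← h1, Fintype.sum_prod_type_right]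
    rw [Fintype.sum_prod_type]
    simp only [← Finset.mul_sum, ← Finset.sum_mul]
    rw [e1, e2, one_mul]
  have hMI : mutInfo μ * Real.log 2
      = ∑ p : α × β, μ p * (Real.log (μ p) - Real.log (μ₁ p.1) - Real.log (μ₂ p.2)) := by
    have e1 : ∑ p : α × β, μ p * Real.log (μ₁ p.1) = ∑ a, μ₁ a * Real.log (μ₁ a) := by
      rw [Fintype.sum_prod_type]
      simp only [← Finset.sum_mul, hμ₁]
    have e2 : ∑ p : α × β, μ p * Real.log (μ₂ p.2) = ∑ b, μ₂ b * Real.log (μ₂ b) := by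
      rw [Fintype.sum_prod_type_right]
      simp only [← Finset.sum_mul, hμ₂]
    simp only [mul_sub, Finset.sum_sub_distrib]
    rw [e1, e2, mutInfo, sub_mul, add_mul, ent_mul_log_two, ent_mul_log_two, ent_mul_log_two]
    ring
  have hterm : ∀ p : α × β,
      (if p ∈ G then μ p * Real.log w - (w - 1) * (μ₁ p.1 * μ₂ p.2) else 0)
          + (μ p - μ₁ p.1 * μ₂ p.2)
        ≤ μ p * (Real.log (μ p) - Real.log (μ₁ p.1) - Real.log (μ₂ p.2)) := by
    rintro ⟨a, b⟩
    have ha : μ (a, b) ≤ μ₁ a :=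
      Finset.single_le_sum (f := fun b => μ (a, b)) (fun b _ => h0 (a, b)) (Finset.mem_univ b)
    have hb : μ (a, b) ≤ μ₂ b :=
      Finset.single_le_sum (f := fun a => μ (a, b)) (fun a _ => h0 (a, b)) (Finset.mem_univ a)
    split_ifs
    · have := mul_log_add_sub_le (h0 (a, b)) ha hb hw
      dsimp only
      linarith
    · have := mul_log_add_sub_le (h0 (a, b)) ha hb one_pos
      rw [Real.log_one] at this
      dsimp only
      linarith
  have hsum := Finset.sum_le_sum fun p (_ : p ∈ Finset.univ) => hterm p
  rw [Finset.sum_add_distrib, Finset.sum_sub_distrib, h1, hprod, sub_self, add_zero,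
    Finset.sum_ite_mem, Finset.univ_inter, Finset.sum_sub_distrib, ← Finset.sum_mul,
    ← Finset.mul_sum] at hsum
  rw [hMI]
  exact hsum

/-- If `W` equiprobable inputs of a channel can be decoded with probability `1/2`, then the
mutual information between input and output is of order `log |W|`, times the mass of `W`. -/
lemma le_mutInfo_of_decodable {ι α β : Type*} [Fintype α] [Fintype β] (P : α → ℝ)
    (A : α → β → ℝ) (hP : ∀ s, 0 ≤ P s) (hP1 : ∑ s, P s = 1) (hA : ∀ s k, 0 ≤ A s k)
    (hA1 : ∀ s, ∑ k, A s k = 1) (W : Finset ι) (hW : W.Nonempty) (σ : ι → α)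
    (hσ : Set.InjOn σ W) (E : ι → Finset β) (hE : (W : Set ι).PairwiseDisjoint E)
    (hAE : ∀ t ∈ W, 1 / 2 ≤ ∑ k ∈ E t, A (σ t) k) {q : ℝ} (hq : ∀ t ∈ W, P (σ t) = q) :
    W.card * q * (Real.log W.card / 2 - 1)
      ≤ mutInfo (fun p : α × β => P p.1 * A p.1 p.2) * Real.log 2 := by
  have hr : (1 : ℝ) ≤ W.card := by exact_mod_cast hW.card_pos
  have hq0 : 0 ≤ q := by
    obtain ⟨t, ht⟩ := hW
    exact hq t ht ▸ hP _
  have h1 : ∑ p : α × β, P p.1 * A p.1 p.2 = 1 := by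
    rw [Fintype.sum_prod_type]
    simp only [← Finset.mul_sum, hA1, mul_one, hP1]
  have key := le_mutInfo_of_event (fun p : α × β => P p.1 * A p.1 p.2)
    (fun p => mul_nonneg (hP _) (hA _ _)) h1 (W.biUnion fun t => {σ t} ×ˢ E t)
    (w := W.card) (by linarith)
  have hdisj : (W : Set ι).PairwiseDisjoint fun t => ({σ t} : Finset α) ×ˢ E t := by
    intro t ht t' ht' hne
    refine Finset.disjoint_product.2 (Or.inl ?_)
    rw [Finset.disjoint_singleton]
    exact fun h => hne (hσ ht ht' h)
  rw [Finset.sum_biUnion hdisj, Finset.sum_biUnion hdisj] at key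
  simp only [Finset.sum_product, Finset.sum_singleton, ← Finset.mul_sum, hA1, mul_one] at key
  have hjoint : W.card * q / 2 ≤ ∑ t ∈ W, P (σ t) * ∑ k ∈ E t, A (σ t) k := by
    have : ∑ _t ∈ W, q / 2 ≤ ∑ t ∈ W, P (σ t) * ∑ k ∈ E t, A (σ t) k := by
      refine Finset.sum_le_sum fun t ht => ?_
      rw [hq t ht]
      nlinarith [hAE t ht]
    rw [Finset.sum_const, nsmul_eq_mul] at this
    linarith
  have hprod : ∑ t ∈ W, P (σ t) * ∑ k ∈ E t, ∑ s, P s * A s k ≤ q := by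
    rw [Finset.sum_congr rfl fun t ht => by rw [hq t ht], ← Finset.mul_sum,
      ← Finset.sum_biUnion hE]
    refine mul_le_of_le_one_right hq0 ?_
    calc ∑ k ∈ W.biUnion E, ∑ s, P s * A s k
        ≤ ∑ k, ∑ s, P s * A s k :=
          Finset.sum_le_sum_of_subset_of_nonneg (Finset.subset_univ _) fun k _ _ =>
            Finset.sum_nonneg fun s _ => mul_nonneg (hP s) (hA s k)
      _ = 1 := by rw [Finset.sum_comm, ← h1, Fintype.sum_prod_type]
  have hlog : 0 ≤ Real.log W.card := Real.log_nonneg hr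
  have b1 := mul_le_mul_of_nonneg_right hjoint hlog
  have b2 := mul_le_mul_of_nonneg_left hprod (sub_nonneg.2 hr)
  nlinarith

/-- Given distributions `Q i j` supported on `(i, j]`, every block of `2 ^ d` points contains a
point `x` whose row and column together contain `d` distributions, decodable with probability
`1/2` within the row and within the column. -/
lemma exists_decodable_row_col {N : ℕ} (Q : Fin N → Fin N → Fin N → ℝ)
    (hQ1 : ∀ i j, i < j → ∑ k ∈ Finset.Ioc i j, Q i j k = 1) (d a : ℕ) (had : a + 2 ^ d ≤ N) :
    ∃ x : Fin N, a ≤ x ∧ (x : ℕ) < a + 2 ^ d ∧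
      ∃ (Y Z : Finset (Fin N)) (E F : Fin N → Finset (Fin N)),
        d ≤ Y.card + Z.card ∧
        (∀ y ∈ Y, x < y ∧ (y : ℕ) < a + 2 ^ d ∧ E y ⊆ Finset.Ioc x y ∧
          1 / 2 ≤ ∑ k ∈ E y, Q x y k) ∧
        (Y : Set (Fin N)).PairwiseDisjoint E ∧
        (∀ z ∈ Z, z < x ∧ a ≤ (z : ℕ) ∧ F z ⊆ Finset.Ioc z x ∧
          1 / 2 ≤ ∑ k ∈ F z, Q z x k) ∧
        (Z : Set (Fin N)).PairwiseDisjoint F := by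
  induction d generalizing a with
  | zero =>
    exact ⟨⟨a, by rw [pow_zero] at had; omega⟩, le_rfl, by simp, ∅, ∅, fun _ => ∅, fun _ => ∅, by simp⟩
  | succ d ih =>
    have hpow : 2 ^ (d + 1) = 2 ^ d + 2 ^ d := by ring
    have hpos : 0 < 2 ^ d := by positivity
    obtain ⟨x, hax, hxa, Y, Z, E, F, hc, hY, hYE, hZ, hZF⟩ := ih a (by omega)
    obtain ⟨x', hax', hxa', Y', Z', E', F', hc', hY', hYE', hZ', hZF'⟩ :=
      ih (a + 2 ^ d) (by omega)
    have hlt : x < x' := Fin.lt_def.2 (by omega)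
    have hsplit : 1 = ∑ k ∈ (Finset.Ioc x x').filter (fun k : Fin N => a + 2 ^ d ≤ (k : ℕ)), Q x x' k
        + ∑ k ∈ (Finset.Ioc x x').filter (fun k : Fin N => ¬ a + 2 ^ d ≤ (k : ℕ)), Q x x' k := by
      rw [Finset.sum_filter_add_sum_filter_not, hQ1 x x' hlt]
    rcases le_total (1 / 2) (∑ k ∈ (Finset.Ioc x x').filter (fun k : Fin N => a + 2 ^ d ≤ (k : ℕ)),
      Q x x' k) with h | h
    · have hx'Y : x' ∉ Y := fun hm => by have := (hY x' hm).2.1; omega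
      refine ⟨x, hax, by omega, insert x' Y, Z, Function.update E x'
        ((Finset.Ioc x x').filter (fun k : Fin N => a + 2 ^ d ≤ (k : ℕ))), F, ?_, ?_, ?_, hZ, hZF⟩
      · rw [Finset.card_insert_of_notMem hx'Y]; omega
      · intro y hy
        rcases Finset.mem_insert.1 hy with rfl | hy
        · rw [Function.update_self]
          exact ⟨hlt, by omega, Finset.filter_subset _ _, h⟩
        · rw [Function.update_of_ne (ne_of_mem_of_not_mem hy hx'Y)]
          obtain ⟨h1, h2, h3⟩ := hY y hy
          exact ⟨h1, by omega, h3⟩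
      · rw [Finset.coe_insert, Set.pairwiseDisjoint_insert]
        refine ⟨fun y hy z hz hne => ?_, fun y hy _ => ?_⟩
        · have e1 : y ≠ x' := ne_of_mem_of_not_mem hy hx'Y
          have e2 : z ≠ x' := ne_of_mem_of_not_mem hz hx'Y
          simpa [Function.onFun, Function.update_of_ne e1, Function.update_of_ne e2]
            using hYE hy hz hne
        · rw [Function.update_self, Function.update_of_ne (ne_of_mem_of_not_mem hy hx'Y),
            Finset.disjoint_left]
          intro k hk hk'
          have h1 := (Finset.mem_filter.1 hk).2
          have h2 := Fin.le_def.1 (Finset.mem_Ioc.1 ((hY y hy).2.2.1 hk')).2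
          have h3 := (hY y hy).2.1
          omega
    · have hxZ : x ∉ Z' := fun hm => by have := (hZ' x hm).2.1; omega
      refine ⟨x', by omega, by omega, Y', insert x Z', E', Function.update F' x
        ((Finset.Ioc x x').filter (fun k : Fin N => ¬ a + 2 ^ d ≤ (k : ℕ))), ?_, ?_, hYE', ?_, ?_⟩
      · rw [Finset.card_insert_of_notMem hxZ]; omega
      · intro y hy
        obtain ⟨h1, h2, h3⟩ := hY' y hy
        exact ⟨h1, by omega, h3⟩
      · intro z hz
        rcases Finset.mem_insert.1 hz with rfl | hz
        · rw [Function.update_self]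
          exact ⟨hlt, hax, Finset.filter_subset _ _, by linarith⟩
        · rw [Function.update_of_ne (ne_of_mem_of_not_mem hz hxZ)]
          obtain ⟨h1, h2, h3⟩ := hZ' z hz
          exact ⟨h1, by omega, h3⟩
      · rw [Finset.coe_insert, Set.pairwiseDisjoint_insert]
        refine ⟨fun y hy z hz hne => ?_, fun z hz _ => ?_⟩
        · have e1 : y ≠ x := ne_of_mem_of_not_mem hy hxZ
          have e2 : z ≠ x := ne_of_mem_of_not_mem hz hxZ
          simpa [Function.onFun, Function.update_of_ne e1, Function.update_of_ne e2]
            using hZF' hy hz hne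
        · rw [Function.update_self, Function.update_of_ne (ne_of_mem_of_not_mem hz hxZ),
            Finset.disjoint_left]
          intro k hk hk'
          have h1 := (Finset.mem_filter.1 hk).2
          have h2 := Fin.lt_def.1 (Finset.mem_Ioc.1 ((hZ' z hz).2.2.1 hk')).1
          have h3 := (hZ' z hz).2.1
          omega

/-- The sample with `u` at position `a`, `w` at position `b` and `p` elsewhere. -/
def paddedSample {m : ℕ} {Ω : Type*} (a b : Fin m) (p u w : Ω) : Fin m → Ω :=
  fun t => if t = a then u else if t = b then w else p

lemma paddedSample_swap {m : ℕ} {Ω : Type*} {a b : Fin m} (hab : a ≠ b) (p u w : Ω) :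
    paddedSample a b p u w = paddedSample b a p w u := by
  funext t
  unfold paddedSample
  split_ifs <;> simp_all

lemma prod_paddedSample {m : ℕ} {Ω : Type*} {a b : Fin m} (hab : a ≠ b) (p u w : Ω)
    (D : Ω → ℝ) : ∏ t, D (paddedSample a b p u w t) = D u * D w * D p ^ (m - 2) := by
  rw [← Finset.mul_prod_erase _ _ (Finset.mem_univ a),
    ← Finset.mul_prod_erase _ _ (Finset.mem_erase.2 ⟨hab.symm, Finset.mem_univ b⟩),
    Finset.prod_congr rfl (g := fun _ => D p), Finset.prod_const,
    Finset.card_erase_of_mem (Finset.mem_erase.2 ⟨hab.symm, Finset.mem_univ b⟩),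
    Finset.card_erase_of_mem (Finset.mem_univ a), Finset.card_univ, Fintype.card_fin,
    Nat.sub_sub, ← mul_assoc]
  · simp [paddedSample, hab.symm]
  · intro t ht
    simp only [Finset.mem_erase, Finset.mem_univ, and_true] at ht
    simp [paddedSample, ht.1, ht.2]

lemma exp_neg_two_le_pow {m : ℕ} (hm : 4 ≤ m) :
    Real.exp (-2) ≤ (1 - 2 / (m : ℝ)) ^ (m - 2) := by
  obtain ⟨k, rfl⟩ : ∃ k, m = k + 2 := ⟨m - 2, by omega⟩
  have hk : (0 : ℝ) < k := by exact_mod_cast (by omega : 0 < k)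
  have h1 : (1 - 2 / ((k + 2 : ℕ) : ℝ)) = (2 / (k : ℝ) + 1)⁻¹ := by
    push_cast
    field_simp
    ring
  have h2 : (2 / (k : ℝ) + 1) ^ k ≤ Real.exp 2 := by
    calc (2 / (k : ℝ) + 1) ^ k ≤ Real.exp (2 / k) ^ k :=
          pow_le_pow_left₀ (by positivity) (Real.add_one_le_exp _) _
      _ = Real.exp 2 := by
          rw [← Real.exp_nat_mul]
          congr 1
          field_simp
  rw [h1, Nat.add_sub_cancel, Real.exp_neg, inv_pow]
  exact inv_anti₀ (by positivity) h2

/-- A family `W` of sample points that a learner reveals with probability `1/2`, when placed in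
an otherwise constant sample, yields a distribution with large mutual information. -/
lemma exists_dist_of_decodable {Ω β : Type*} [Fintype Ω] [Fintype β] {m : ℕ} (hm : 4 ≤ m)
    (A : (Fin m → Ω) → β → ℝ) (hA : ∀ s, (∀ k, 0 ≤ A s k) ∧ ∑ k, A s k = 1)
    {a b : Fin m} (hab : a ≠ b) {p u : Ω} (hpu : p ≠ u) (W : Finset Ω) (hW : W.Nonempty)
    (hpW : p ∉ W) (huW : u ∉ W) (E : Ω → Finset β) (hE : (W : Set Ω).PairwiseDisjoint E)
    (hAE : ∀ w ∈ W, 1 / 2 ≤ ∑ k ∈ E w, A (paddedSample a b p u w) k)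
    (hcard : 2 ≤ Real.log W.card) :
    ∃ D : Ω → ℝ, (∀ z, 0 ≤ D z) ∧ ∑ z, D z = 1 ∧ (∀ z, z ≠ p → z ≠ u → z ∉ W → D z = 0) ∧
      Real.exp (-2) / (m : ℝ) ^ 2 * (Real.log W.card / 2 - 1)
        ≤ mutInfo (fun q : (Fin m → Ω) × β => (∏ i, D (q.1 i)) * A q.1 q.2) * Real.log 2 := by
  have hm' : (4 : ℝ) ≤ m := by exact_mod_cast hm
  have hr : (0 : ℝ) < W.card := by exact_mod_cast hW.card_pos
  set D : Ω → ℝ := fun z => (if z = p then 1 - 2 / (m : ℝ) else 0)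
    + (if z = u then 1 / (m : ℝ) else 0) + (if z ∈ W then 1 / (m * W.card : ℝ) else 0) with hD
  have hpad : 0 ≤ 1 - 2 / (m : ℝ) := by
    rw [sub_nonneg, div_le_one (by linarith)]
    linarith
  have hD0 : ∀ z, 0 ≤ D z := fun z => by
    simp only [hD]
    refine add_nonneg (add_nonneg ?_ ?_) ?_ <;> split_ifs <;> positivity
  have hD1 : ∑ z, D z = 1 := by
    simp only [hD, Finset.sum_add_distrib, Finset.sum_ite_eq', Finset.sum_ite_mem,
      Finset.mem_univ, if_true, Finset.univ_inter, Finset.sum_const, nsmul_eq_mul]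
    field_simp
    ring
  refine ⟨D, hD0, hD1, fun z h1 h2 h3 => by simp [hD, h1, h2, h3], ?_⟩
  have hDp : D p = 1 - 2 / (m : ℝ) := by simp [hD, hpu, hpW]
  have hDu : D u = 1 / (m : ℝ) := by simp [hD, hpu.symm, huW]
  have hDw : ∀ w ∈ W, D w = 1 / (m * W.card : ℝ) := fun w hw => by
    have e1 : w ≠ p := ne_of_mem_of_not_mem hw hpW
    have e2 : w ≠ u := ne_of_mem_of_not_mem hw huW
    simp [hD, e1, e2, hw]
  have key := le_mutInfo_of_decodable (fun s : Fin m → Ω => ∏ i, D (s i)) A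
    (fun s => Finset.prod_nonneg fun i _ => hD0 _)
    (by rw [← Fintype.piFinset_univ, ← Finset.prod_univ_sum]; simp [hD1])
    (fun s => (hA s).1) (fun s => (hA s).2) W hW (paddedSample a b p u)
    (fun w _ w' _ h => by simpa [paddedSample, hab.symm] using congrFun h b) E hE hAE
    (q := 1 / (m : ℝ) * (1 / (m * W.card : ℝ)) * (1 - 2 / (m : ℝ)) ^ (m - 2))
    (fun w hw => by rw [prod_paddedSample hab, hDp, hDu, hDw w hw])
  refine le_trans (mul_le_mul_of_nonneg_right ?_ (by linarith)) key
  have e : (W.card : ℝ) * (1 / (m : ℝ) * (1 / (m * W.card : ℝ)) * (1 - 2 / (m : ℝ)) ^ (m - 2))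
      = (1 - 2 / (m : ℝ)) ^ (m - 2) / (m : ℝ) ^ 2 := by
    field_simp
  rw [e]
  gcongr
  exact exp_neg_two_le_pow hm

lemma trueErr_eq_zero {X : Type*} [Fintype X] {D : X × Bool → ℝ} {h : X → Bool}
    (hD : ∀ z, h z.1 ≠ z.2 → D z = 0) : trueErr D h = 0 := by
  refine Finset.sum_eq_zero fun z _ => ?_
  split_ifs with hz
  · rw [hD z hz, zero_mul]
  · rw [mul_zero]

lemma pairwiseDisjoint_product_singleton {α β γ : Type*} {Y : Finset α} {E : α → Finset γ}
    (hE : (Y : Set α).PairwiseDisjoint E) (c : β) :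
    ((Y ×ˢ {c} : Finset (α × β)) : Set (α × β)).PairwiseDisjoint fun w => E w.1 := by
  rintro ⟨a, b⟩ h ⟨a', b'⟩ h' hne
  simp only [Finset.coe_product, Set.mem_prod, Finset.coe_singleton, Set.mem_singleton_iff]
    at h h'
  obtain ⟨h, rfl⟩ := h
  obtain ⟨h', rfl⟩ := h'
  exact hE h h' fun e => hne (congrArg (·, b') e)

lemma log_card_bound {n r : ℕ} (hn : 4096 ≤ n) (hr : n ≤ 2 * r + 2) :
    2 ≤ Real.log r ∧ Real.log n / 4 ≤ Real.log r / 2 - 1 := by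
  have hn' : (4096 : ℝ) ≤ n := by exact_mod_cast hn
  have hr' : (n : ℝ) ≤ 2 * r + 2 := by exact_mod_cast hr
  have h4 : Real.log 4 = 2 * Real.log 2 := by
    rw [show (4 : ℝ) = 2 ^ 2 by norm_num, Real.log_pow]; norm_num
  have h12 : Real.log 4096 = 12 * Real.log 2 := by
    rw [show (4096 : ℝ) = 2 ^ 12 by norm_num, Real.log_pow]; norm_num
  have h1 : Real.log 4096 ≤ Real.log n := Real.log_le_log (by norm_num) hn'
  have h2 : Real.log (n / 4) ≤ Real.log r :=
    Real.log_le_log (by linarith) (by linarith)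
  rw [Real.log_div (by linarith) (by norm_num)] at h2
  have := Real.log_two_gt_d9
  constructor <;> linarith

/-- There are `c > 0` and `n₀` such that for all `n ≥ n₀` and `m ≥ 4`,
every (possibly randomized) consistent proper learner `A` for the class of thresholds over
`[2^n]` (a map from samples to distributions over thresholds, supported on thresholds with
zero empirical error whenever the sample is realizable) admits a realizable distribution
`D` for which the mutual information between `S ~ D^m` and the output is at least
`c·log₂(n)/m²`. -/
theorem stmt5 :
    ∃ c : ℝ, 0 < c ∧ ∃ n₀ : ℕ, ∀ n : ℕ, n₀ ≤ n → ∀ m : ℕ, 4 ≤ m →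
      ∀ A : (Fin m → Fin (2 ^ n) × Bool) → (Fin (2 ^ n) → ℝ),
        (∀ s, (∀ k, 0 ≤ A s k) ∧ ∑ k, A s k = 1) →
        (∀ s : Fin m → Fin (2 ^ n) × Bool,
          (∃ k : Fin (2 ^ n), ∀ i, thr k (s i).1 = (s i).2) →
          ∀ k : Fin (2 ^ n), ¬ (∀ i, thr k (s i).1 = (s i).2) → A s k = 0) →
        ∃ D : Fin (2 ^ n) × Bool → ℝ,
          (∀ z, 0 ≤ D z) ∧ (∑ z, D z = 1) ∧
          (∃ k : Fin (2 ^ n), trueErr D (thr k) = 0) ∧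
          c * Real.logb 2 n / (m : ℝ) ^ 2 ≤
            mutInfo (fun p : (Fin m → Fin (2 ^ n) × Bool) × Fin (2 ^ n) =>
              (∏ i, D (p.1 i)) * A p.1 p.2) := by
  refine ⟨Real.exp (-2) / 4, by positivity, 4096, fun n hn m hm A hA hcons => ?_⟩
  have hN : 1 + 2 ^ (n - 1) ≤ 2 ^ n := by
    obtain ⟨k, rfl⟩ : ∃ k, n = k + 1 := ⟨n - 1, by omega⟩
    have := Nat.one_le_two_pow (n := k)
    rw [Nat.add_sub_cancel, pow_succ]
    omega
  set o : Fin (2 ^ n) := ⟨0, by positivity⟩ with ho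
  have h01 : (⟨0, by omega⟩ : Fin m) ≠ ⟨1, by omega⟩ := by simp
  set sample : Fin (2 ^ n) → Fin (2 ^ n) → Fin m → Fin (2 ^ n) × Bool := fun i j =>
    paddedSample ⟨0, by omega⟩ ⟨1, by omega⟩ (o, false) (i, false) (j, true) with hsample
  have hQ1 : ∀ i j, i < j → ∑ k ∈ Finset.Ioc i j, A (sample i j) k = 1 := by
    intro i j hij
    rw [← (hA (sample i j)).2]
    refine Finset.sum_subset (Finset.subset_univ _) fun k _ hk => hcons _ ⟨j, fun t => ?_⟩ k ?_
    · have hoj : ¬ j ≤ o := not_le.2 (lt_of_le_of_lt (Fin.le_def.2 (Nat.zero_le _)) hij)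
      simp only [hsample, paddedSample, thr]
      split_ifs <;> simp [hoj, hij]
    · intro h
      refine hk (Finset.mem_Ioc.2 ⟨?_, ?_⟩)
      · simpa [hsample, paddedSample, thr] using h ⟨0, by omega⟩
      · simpa [hsample, paddedSample, thr, if_neg h01.symm] using h ⟨1, by omega⟩
  obtain ⟨x, hx, -, Y, Z, E, F, hc, hY, hYE, hZ, hZF⟩ :=
    exists_decodable_row_col (fun i j => A (sample i j)) hQ1 (n - 1) 1 hN
  have hox : o < x := Fin.lt_def.2 hx
  -- it remains to handle the larger of the row and the column through `x`
  suffices h : ∃ (r : ℕ) (D : Fin (2 ^ n) × Bool → ℝ), n ≤ 2 * r + 2 ∧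
      (∀ z, 0 ≤ D z) ∧ (∑ z, D z = 1) ∧ (∃ k : Fin (2 ^ n), trueErr D (thr k) = 0) ∧
      Real.exp (-2) / (m : ℝ) ^ 2 * (Real.log r / 2 - 1) ≤
        mutInfo (fun p : (Fin m → Fin (2 ^ n) × Bool) × Fin (2 ^ n) =>
          (∏ i, D (p.1 i)) * A p.1 p.2) * Real.log 2 by
    obtain ⟨r, D, hr, hD0, hD1, hk, hI⟩ := h
    refine ⟨D, hD0, hD1, hk, ?_⟩
    have hlog2 : 0 < Real.log 2 := Real.log_pos one_lt_two
    refine le_of_mul_le_mul_right (le_trans ?_ hI) hlog2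
    have hle := mul_le_mul_of_nonneg_left (log_card_bound hn hr).2
      (show 0 ≤ Real.exp (-2) / (m : ℝ) ^ 2 by positivity)
    refine le_trans (le_of_eq ?_) hle
    rw [Real.logb]
    field_simp
  rcases (by omega : n ≤ 2 * Y.card + 2 ∨ n ≤ 2 * Z.card + 2) with hr | hr
  · have hne : Y.Nonempty := Finset.card_pos.1 (by omega)
    set W : Finset (Fin (2 ^ n) × Bool) := Y ×ˢ {true} with hW
    have hcard : W.card = Y.card := by simp [hW]
    obtain ⟨D, hD0, hD1, hDs, hI⟩ := exists_dist_of_decodable hm A hA h01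
      (p := (o, false)) (u := (x, false)) (by simp [hox.ne]) W (hne.product (by simp))
      (by simp [hW]) (by simp [hW]) (fun w => E w.1)
      (pairwiseDisjoint_product_singleton hYE _)
      (by
        rintro ⟨w, c⟩ hw
        simp only [hW, Finset.mem_product, Finset.mem_singleton] at hw
        obtain ⟨hw, rfl⟩ := hw
        exact (hY w hw).2.2.2)
      (by rw [hcard]; exact (log_card_bound hn hr).1)
    refine ⟨Y.card, D, hr, hD0, hD1, ⟨Y.min' hne, trueErr_eq_zero fun z hz => ?_⟩, hcard ▸ hI⟩
    have hmin : x < Y.min' hne := (hY _ (Y.min'_mem hne)).1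
    refine hDs z ?_ ?_ ?_
    · rintro rfl; exact hz (by simpa [thr] using hox.trans hmin)
    · rintro rfl; exact hz (by simpa [thr] using hmin)
    · obtain ⟨z, c⟩ := z
      intro hw
      simp only [hW, Finset.mem_product, Finset.mem_singleton] at hw
      obtain ⟨hw, rfl⟩ := hw
      exact hz (by simpa [thr] using Y.min'_le z hw)
  · have hne : Z.Nonempty := Finset.card_pos.1 (by omega)
    set W : Finset (Fin (2 ^ n) × Bool) := Z ×ˢ {false} with hW
    have hcard : W.card = Z.card := by simp [hW]
    have hoZ : o ∉ Z := fun h => by simpa [ho] using (hZ o h).2.1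
    obtain ⟨D, hD0, hD1, hDs, hI⟩ := exists_dist_of_decodable hm A hA h01.symm
      (p := (o, false)) (u := (x, true)) (by simp) W (hne.product (by simp))
      (by simpa [hW] using hoZ) (by simp [hW]) (fun w => F w.1)
      (pairwiseDisjoint_product_singleton hZF _)
      (by
        rintro ⟨w, c⟩ hw
        simp only [hW, Finset.mem_product, Finset.mem_singleton] at hw
        obtain ⟨hw, rfl⟩ := hw
        rw [paddedSample_swap h01.symm]
        exact (hZ w hw).2.2.2)
      (by rw [hcard]; exact (log_card_bound hn hr).1)
    refine ⟨Z.card, D, hr, hD0, hD1, ⟨x, trueErr_eq_zero fun z hz => ?_⟩, hcard ▸ hI⟩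
    refine hDs z ?_ ?_ ?_
    · rintro rfl; exact hz (by simpa [thr] using hox)
    · rintro rfl; exact hz (by simp [thr])
    · obtain ⟨z, c⟩ := z
      intro hw
      simp only [hW, Finset.mem_product, Finset.mem_singleton] at hw
      obtain ⟨hw, rfl⟩ := hw
      exact hz (by simpa [thr] using (hZ z hw).1)
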